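/- Let λ ∈ ℝ and let u : ℝ × ℝ → ℝ be smooth, spatially periodic, and satisfy the μ-equation μ(u_t)(t) − u_txx + λ μ(u)(t) u_x − λ u_x u_xx − u u_xxx = 0 at every point of ℝ × ℝ. Then the mean t ↦ μ(u)(t) = ∫₀¹ u(t,x) dx is constant in t. If moreover λ = 3 (the μDP equation), then also t ↦ ∫₀¹ u(t,x)² dx is constant in t. -/

import Mathlib

open intervalIntegral

/-- Partial derivative in the second (spatial) variable. -/
noncomputable def pdx (u : ℝ × ℝ → ℝ) : ℝ × ℝ → ℝ := fun p => deriv (fun y => u (p.1, y)) p.2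

/-- Partial derivative in the first (time) variable. -/
noncomputable def pdt (u : ℝ × ℝ → ℝ) : ℝ × ℝ → ℝ := fun p => deriv (fun s => u (s, p.2)) p.1

/-- The spatial mean `μ(u)(t) = ∫₀¹ u(t,x) dx`. -/
noncomputable def muMean (u : ℝ × ℝ → ℝ) (t : ℝ) : ℝ := ∫ x in (0:ℝ)..1, u (t, x)

theorem ContDiff.deriv_smooth {f : ℝ → ℝ} (hf : ContDiff ℝ (⊤ : ℕ∞) f) :
    ContDiff ℝ (⊤ : ℕ∞) (deriv f) :=
  ((contDiff_infty_iff_deriv).1 hf).2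

theorem Function.Periodic.deriv_periodic {f : ℝ → ℝ} {c : ℝ} (hf : Function.Periodic f c) :
    Function.Periodic (deriv f) c := fun x => by
  rw [← deriv_comp_add_const, funext hf]

/-- The integral over a period of the derivative of a periodic function vanishes. -/
theorem Function.Periodic.integral_eq_zero_of_hasDerivAt {f f' : ℝ → ℝ} {c : ℝ}
    (hf : Function.Periodic f c) (hd : ∀ x, HasDerivAt f (f' x) x) (hc : Continuous f') :
    ∫ x in (0:ℝ)..c, f' x = 0 := by
  rw [integral_eq_sub_of_hasDerivAt (fun x _ => hd x) (hc.intervalIntegrable _ _)]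
  simpa using sub_eq_zero.2 (hf 0)

theorem eq_of_forall_hasDerivAt_zero {f : ℝ → ℝ} (hf : ∀ x, HasDerivAt f 0 x) (x y : ℝ) :
    f x = f y :=
  is_const_of_deriv_eq_zero (fun x => (hf x).differentiableAt) (fun x => (hf x).deriv) x y

/-- The μ-equation on a time slice, with `f = u` and `g = u_t`, forces `m = μ(u_t)` to vanish. -/
theorem mu_slice_mean_eq_zero {lam m M : ℝ} {f g : ℝ → ℝ}
    (hf : ContDiff ℝ (⊤ : ℕ∞) f) (hg : ContDiff ℝ (⊤ : ℕ∞) g)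
    (hfp : Function.Periodic f 1) (hgp : Function.Periodic g 1)
    (heq : ∀ x, m - deriv (deriv g) x + lam * M * deriv f x
      - lam * deriv f x * deriv (deriv f) x - f x * deriv (deriv (deriv f)) x = 0) :
    m = 0 := by
  have d {h : ℝ → ℝ} (hh : ContDiff ℝ (⊤ : ℕ∞) h) (x : ℝ) : HasDerivAt h (deriv h x) x :=
    (hh.differentiable (by simp) x).hasDerivAt
  have key (x : ℝ) : HasDerivAt (fun x => m * x - deriv g x + lam * M * f x
      - lam / 2 * (deriv f x * deriv f x) - (f x * deriv (deriv f) x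
        - 1 / 2 * (deriv f x * deriv f x))) 0 x := by
    have h0 := d hf x
    have h1 := d hf.deriv_smooth x
    have h2 := d hf.deriv_smooth.deriv_smooth x
    have k1 := d hg.deriv_smooth x
    refine (((((hasDerivAt_id x).const_mul m).sub k1).add (h0.const_mul (lam * M))).sub
      ((h1.mul h1).const_mul (lam / 2)) |>.sub
      ((h0.mul h2).sub ((h1.mul h1).const_mul (1 / 2)))).congr_deriv ?_
    linear_combination heq x
  have h := eq_of_forall_hasDerivAt_zero key 1 0
  have e0 := hfp 0
  have e1 := hfp.deriv_periodic 0
  have e2 := hfp.deriv_periodic.deriv_periodic 0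
  have e3 := hgp.deriv_periodic 0
  rw [zero_add] at e0 e1 e2 e3
  rw [e0, e1, e2, e3] at h
  linarith

/-- On a time slice of the μDP equation, with `f = u` and `g = u_t`, one has `∫ u u_t = 0`. -/
theorem muDP_slice_integral_mul_eq_zero {f g : ℝ → ℝ}
    (hf : ContDiff ℝ (⊤ : ℕ∞) f) (hg : ContDiff ℝ (⊤ : ℕ∞) g)
    (hfp : Function.Periodic f 1) (hgp : Function.Periodic g 1)
    (hg0 : ∫ x in (0:ℝ)..1, g x = 0)
    (heq : ∀ x, deriv (deriv g) x = 3 * (∫ x in (0:ℝ)..1, f x) * deriv f x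
      - 3 * deriv f x * deriv (deriv f) x - f x * deriv (deriv (deriv f)) x) :
    ∫ x in (0:ℝ)..1, f x * g x = 0 := by
  have d {h : ℝ → ℝ} (hh : ContDiff ℝ (⊤ : ℕ∞) h) (x : ℝ) : HasDerivAt h (deriv h x) x :=
    (hh.differentiable (by simp) x).hasDerivAt
  set M := ∫ x in (0:ℝ)..1, f x with hM
  have cf := hf.continuous
  have cg := hg.continuous
  have cf' := hf.deriv_smooth.continuous
  obtain ⟨c, hc⟩ : ∃ c, ∀ x, deriv g x + deriv f x * deriv f x + f x * deriv (deriv f) x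
      = 3 * M * f x + c := by
    refine ⟨_, fun x => sub_eq_iff_eq_add'.1 (eq_of_forall_hasDerivAt_zero (f := fun x =>
      deriv g x + deriv f x * deriv f x + f x * deriv (deriv f) x - 3 * M * f x)
      (fun x => ?_) x 0)⟩
    have h0 := d hf x
    have h1 := d hf.deriv_smooth x
    have h2 := d hf.deriv_smooth.deriv_smooth x
    have k1 := d hg.deriv_smooth x
    refine (((k1.add (h1.mul h1)).add (h0.mul h2)).sub (h0.const_mul (3 * M))).congr_deriv ?_
    linear_combination heq x
  set v : ℝ → ℝ := fun x => g x + f x * deriv f x with hv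
  have cv : Continuous v := by fun_prop
  have vp : Function.Periodic v 1 := fun x => by
    simp only [hv, hfp x, hgp x, hfp.deriv_periodic x]
  have dv (x : ℝ) : HasDerivAt v (3 * M * f x + c) x := by
    refine ((d hg x).add ((d hf x).mul (d hf.deriv_smooth x))).congr_deriv ?_
    linear_combination hc x
  have ii {h : ℝ → ℝ} (hh : Continuous h) : IntervalIntegrable h MeasureTheory.volume 0 1 :=
    hh.intervalIntegrable _ _
  have v0 : ∫ x in (0:ℝ)..1, v x = 0 := by
    have h : ∫ x in (0:ℝ)..1, f x * deriv f x = 0 :=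
      Function.Periodic.integral_eq_zero_of_hasDerivAt (f := fun x => 1 / 2 * (f x * f x))
        (fun x => by simp only [hfp x])
        (fun x => (((d hf x).mul (d hf x)).const_mul (1 / 2)).congr_deriv (by ring))
        (by fun_prop)
    rw [integral_add (ii cg) (ii (by fun_prop)), hg0, h, add_zero]
  have fv : ∫ x in (0:ℝ)..1, f x * v x = ∫ x in (0:ℝ)..1, f x * g x := by
    have h : ∫ x in (0:ℝ)..1, f x * (f x * deriv f x) = 0 :=
      Function.Periodic.integral_eq_zero_of_hasDerivAt (f := fun x => 1 / 3 * (f x * f x * f x))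
        (fun x => by simp only [hfp x])
        (fun x => ((((d hf x).mul (d hf x)).mul (d hf x)).const_mul (1 / 3)).congr_deriv
          (by simp only [Pi.mul_apply]; ring))
        (by fun_prop)
    simp only [hv, mul_add]
    rw [integral_add (ii (by fun_prop)) (ii (by fun_prop)), h, add_zero]
  have hMc : 3 * M * M + c = 0 := by
    have h := vp.integral_eq_zero_of_hasDerivAt dv (by fun_prop)
    rw [integral_add (ii (by fun_prop)) (ii (by fun_prop)), integral_const_mul, ← hM] at h
    simpa using h
  have hMv : M * ∫ x in (0:ℝ)..1, f x * v x = 0 := by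
    have h : ∫ x in (0:ℝ)..1, (3 * M * (f x * v x) + c * v x) = 0 :=
      Function.Periodic.integral_eq_zero_of_hasDerivAt (f := fun x => 1 / 2 * (v x * v x))
        (fun x => by simp only [vp x])
        (fun x => (((dv x).mul (dv x)).const_mul (1 / 2)).congr_deriv (by ring))
        (by fun_prop)
    rw [integral_add (ii (by fun_prop)) (ii (by fun_prop)), integral_const_mul,
      integral_const_mul, v0] at h
    linarith
  rw [← fv]
  rcases mul_eq_zero.1 hMv with h | h
  · have hc0 : c = 0 := by simpa [h] using hMc
    have hconst (x : ℝ) : v x = v 0 :=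
      eq_of_forall_hasDerivAt_zero (fun x => by simpa [h, hc0] using dv x) x 0
    have hv0 : v 0 = 0 := by
      rw [funext hconst] at v0
      simpa using v0
    simp [hconst, hv0]
  · exact h

theorem hasDerivAt_pdt {F : ℝ × ℝ → ℝ} (hF : Differentiable ℝ F) (t x : ℝ) :
    HasDerivAt (fun s => F (s, x)) (pdt F (t, x)) t := by
  have h : DifferentiableAt ℝ (fun s => F (s, x)) t := by fun_prop
  exact h.hasDerivAt

theorem ContDiff.pdt {F : ℝ × ℝ → ℝ} (hF : ContDiff ℝ (⊤ : ℕ∞) F) :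
    ContDiff ℝ (⊤ : ℕ∞) (pdt F) := by
  have h : _root_.pdt F = fun p => fderiv ℝ F p (1, 0) := by
    ext ⟨t, x⟩
    exact ((hF.differentiable (by simp) (t, x)).hasFDerivAt.comp_hasDerivAt t
      ((hasDerivAt_id t).prodMk (hasDerivAt_const t x))).deriv
  rw [h]
  exact (hF.fderiv_right (by simp)).clm_apply contDiff_const

/-- Differentiation of the spatial mean under the integral sign. -/
theorem hasDerivAt_muMean {F : ℝ × ℝ → ℝ} (hF : ContDiff ℝ (⊤ : ℕ∞) F) (t : ℝ) :
    HasDerivAt (muMean F) (muMean (pdt F) t) t := by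
  have cF := hF.continuous
  have cF' := hF.pdt.continuous
  obtain ⟨C, hC⟩ := ((isCompact_closedBall t 1).prod (isCompact_uIcc (a := (0:ℝ)) (b := 1))
    ).exists_bound_of_continuousOn cF'.continuousOn
  refine (hasDerivAt_integral_of_dominated_loc_of_deriv_le (bound := fun _ => C)
    (F := fun s x => F (s, x)) (F' := fun s x => pdt F (s, x))
    (Metric.closedBall_mem_nhds t one_pos) (.of_forall fun s => ?_) ?_ ?_
    (.of_forall fun x hx s hs => hC (s, x) ⟨hs, Set.uIoc_subset_uIcc hx⟩)
    intervalIntegrable_const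
    (.of_forall fun x _ s _ => hasDerivAt_pdt (hF.differentiable (by simp)) s x)).2
  · exact Continuous.aestronglyMeasurable (by fun_prop)
  · exact Continuous.intervalIntegrable (by fun_prop) _ _
  · exact Continuous.aestronglyMeasurable (by fun_prop)

/-- for a smooth spatially periodic solution of the μ-equation the mean
`μ(u)` is conserved, and for λ = 3 (μDP) also `∫₀¹ u² dx` is conserved. -/
theorem mu_equation_conserved_mean_and_H1
    (lam : ℝ) (u : ℝ × ℝ → ℝ) (hu : ContDiff ℝ (⊤ : ℕ∞) u)
    (hper : ∀ t x, u (t, x + 1) = u (t, x))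
    (heq : ∀ t x : ℝ,
      muMean (pdt u) t - pdx (pdx (pdt u)) (t, x) + lam * muMean u t * pdx u (t, x)
        - lam * pdx u (t, x) * pdx (pdx u) (t, x) - u (t, x) * pdx (pdx (pdx u)) (t, x) = 0) :
    (∀ t₁ t₂ : ℝ, muMean u t₁ = muMean u t₂) ∧
      (lam = 3 → ∀ t₁ t₂ : ℝ,
        (∫ x in (0:ℝ)..1, u (t₁, x) ^ 2) = ∫ x in (0:ℝ)..1, u (t₂, x) ^ 2) := by
  have slice {F : ℝ × ℝ → ℝ} (hF : ContDiff ℝ (⊤ : ℕ∞) F) (t : ℝ) :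
      ContDiff ℝ (⊤ : ℕ∞) (fun x => F (t, x)) := hF.comp (contDiff_const.prodMk contDiff_id)
  have hf := slice hu
  have hg := slice hu.pdt
  have hgp (t : ℝ) : Function.Periodic (fun x => pdt u (t, x)) 1 := fun x => by
    simp only [pdt, hper]
  have hm (t : ℝ) : muMean (pdt u) t = 0 :=
    mu_slice_mean_eq_zero (hf t) (hg t) (hper t) (hgp t) (heq t)
  refine ⟨eq_of_forall_hasDerivAt_zero fun t => hm t ▸ hasDerivAt_muMean hu t, ?_⟩
  rintro rfl
  refine eq_of_forall_hasDerivAt_zero (f := muMean fun p => u p ^ 2) fun t =>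
    (hasDerivAt_muMean (hu.pow 2) t).congr_deriv ?_
  have hpdt (x : ℝ) : pdt (fun p => u p ^ 2) (t, x) = 2 * (u (t, x) * pdt u (t, x)) := by
    refine ((hasDerivAt_pdt (hu.differentiable (by simp)) t x).pow 2).deriv.trans ?_
    ring
  have h := muDP_slice_integral_mul_eq_zero (hf t) (hg t) (hper t) (hgp t) (hm t) fun x => by
    have e := heq t x
    rw [hm t] at e
    simp only [pdx, muMean] at e
    linear_combination -e
  simp only [muMean, hpdt, integral_const_mul, h, mul_zero]
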